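/- Let (a,b,c,d) ∈ P_gen and let γ ∈ ℂ with |γ| = 1 and γ ≠ 1, γ ≠ −1. Then the 2×2 complex matrices u(γ) = [[u₂(γ), u₁(γ)], [u₁†(γ), u₂(γ)]] and v(γ) = [[v₂(γ), v₁†(γ)], [v₁(γ), v₂(γ)]] are mutually inverse: u(γ)·v(γ) equals the 2×2 identity matrix. -/

import Mathlib

open Complex Filter

noncomputable section

namespace VVBQJ

/-- The infinite q-shifted factorial `(x;q)_∞`. -/
def poch (q x : ℂ) : ℂ := ∏' j : ℕ, (1 - x * q ^ j)

/-- The q-shifted factorial `(x;q)_n`, `n ∈ ℕ`. -/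
def pochN (q x : ℂ) (n : ℕ) : ℂ := ∏ j ∈ Finset.range n, (1 - x * q ^ j)

/-- The normalized Jacobi theta function `θ(x) = (x;q)_∞ (q/x;q)_∞`. -/
def theta (q x : ℂ) : ℂ := poch q x * poch q (q / x)

/-- The condition on the pairs `(a,b)` and `(c,d)` in the parameter set `P`. -/
def pairCond (q zm zp : ℝ) (α β : ℂ) : Prop :=
  α = (starRingEnd ℂ) β ∨
    (∃ (A B : ℝ) (k₀ : ℤ), α = (A : ℂ) ∧ β = (B : ℂ) ∧
      zp * q ^ k₀ < 1 / B ∧ 1 / B < 1 / A ∧ 1 / A < zp * q ^ (k₀ - 1)) ∨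
    (∃ (A B : ℝ) (k₀ : ℤ), α = (A : ℂ) ∧ β = (B : ℂ) ∧
      zm * q ^ (k₀ - 1) < 1 / A ∧ 1 / A < 1 / B ∧ 1 / B < zm * q ^ k₀)

/-- The parameter domain `P`. -/
def memP (q zm zp : ℝ) (a b c d : ℂ) : Prop :=
  a ≠ 0 ∧ b ≠ 0 ∧ c ≠ 0 ∧ d ≠ 0 ∧ a ≠ b ∧
    (∀ x ∈ ({a, b, c, d} : Set ℂ), ∀ k : ℤ,
      x ≠ ((zp : ℂ))⁻¹ * (q : ℂ) ^ k ∧ x ≠ ((zm : ℂ))⁻¹ * (q : ℂ) ^ k) ∧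
    pairCond q zm zp a b ∧ pairCond q zm zp c d

/-- The generic parameter domain `P_gen`. -/
def memPgen (q zm zp : ℝ) (a b c d : ℂ) : Prop :=
  memP q zm zp a b c d ∧ c ≠ d ∧
    ∀ k : ℤ, c / a ≠ (q : ℂ) ^ k ∧ c / b ≠ (q : ℂ) ^ k ∧ d / a ≠ (q : ℂ) ^ k ∧
      d / b ≠ (q : ℂ) ^ k ∧ c * d / (a * b) ≠ (q : ℂ) ^ k

/-- `s = √(cdq/(ab))`, with the principal branch of the square root. -/
def sP (q : ℝ) (a b c d : ℂ) : ℂ := (c * d * (q : ℂ) / (a * b)) ^ ((1 : ℂ) / 2)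

def Acoef (q : ℝ) (a b c d : ℂ) (x : ℝ) : ℂ :=
  (sP q a b c d)⁻¹ * (1 - (q : ℂ) / (a * (x : ℂ))) * (1 - (q : ℂ) / (b * (x : ℂ)))

def Bcoef (q : ℝ) (a b c d : ℂ) (x : ℝ) : ℂ :=
  sP q a b c d * (1 - 1 / (c * (x : ℂ))) * (1 - 1 / (d * (x : ℂ)))

def Ccoef (q : ℝ) (a b c d : ℂ) (x : ℝ) : ℂ :=
  sP q a b c d + (sP q a b c d)⁻¹ - Acoef q a b c d x - Bcoef q a b c d x

/-- The second order q-difference operator `L`. -/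
def Lop (q : ℝ) (a b c d : ℂ) (f : ℝ → ℂ) (x : ℝ) : ℂ :=
  Acoef q a b c d x * f (x / q) + Bcoef q a b c d x * f (q * x) + Ccoef q a b c d x * f x

/-- The weight function `w`. -/
def w (q : ℝ) (a b c d : ℂ) (x : ℝ) : ℂ :=
  poch q (a * (x : ℂ)) * poch q (b * (x : ℂ)) / (poch q (c * (x : ℂ)) * poch q (d * (x : ℂ)))

/-- The function `u(x) = (1-q)² B(x) x² w(x)`. -/
def u (q : ℝ) (a b c d : ℂ) (x : ℝ) : ℂ :=
  (1 - (q : ℂ)) ^ 2 * Bcoef q a b c d x * (x : ℂ) ^ 2 * w q a b c d x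

/-- The Casorati determinant `D(f,g)`. -/
def casD (q : ℝ) (a b c d : ℂ) (f g : ℝ → ℂ) (x : ℝ) : ℂ :=
  (f x * g (q * x) - f (q * x) * g x) * u q a b c d x / ((1 - (q : ℂ)) * (x : ℂ))

/-- The truncated inner product `⟨f,g⟩_{k,l;m,n}`. -/
def trunc (q zm zp : ℝ) (a b c d : ℂ) (f g : ℝ → ℂ) (k l m n : ℤ) : ℂ :=
  (1 - (q : ℂ)) *
    ((∑ j ∈ Finset.Icc n m, f (zp * q ^ j) * (starRingEnd ℂ) (g (zp * q ^ j)) *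
        w q a b c d (zp * q ^ j) * ((zp * q ^ j : ℝ) : ℂ)) -
      ∑ j ∈ Finset.Icc k l, f (zm * q ^ j) * (starRingEnd ℂ) (g (zm * q ^ j)) *
        w q a b c d (zm * q ^ j) * ((zm * q ^ j : ℝ) : ℂ))

/-- The constant `K_z`. -/
def Kz (q : ℝ) (a b c d : ℂ) (z : ℝ) : ℂ :=
  (z : ℂ) * (1 - (q : ℂ)) * (theta q (a * z) * theta q (b * z)) /
    (theta q (c * z) * theta q (d * z))

/-- Membership in the Hilbert space `ℒ²(ℝ_q, w(x) d_q x)`. -/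
def memL2 (q zm zp : ℝ) (a b c d : ℂ) (f : ℝ → ℂ) : Prop :=
  Summable (fun k : ℤ => ‖f (zp * q ^ k)‖ ^ 2 * ‖w q a b c d (zp * q ^ k)‖ * |zp * q ^ k|) ∧
    Summable (fun k : ℤ => ‖f (zm * q ^ k)‖ ^ 2 * ‖w q a b c d (zm * q ^ k)‖ * |zm * q ^ k|)

/-- The inner product on `ℒ²`. -/
def innerL2 (q zm zp : ℝ) (a b c d : ℂ) (f g : ℝ → ℂ) : ℂ :=
  (1 - (q : ℂ)) *
    ((∑' k : ℤ, f (zp * q ^ k) * (starRingEnd ℂ) (g (zp * q ^ k)) *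
        w q a b c d (zp * q ^ k) * ((zp * q ^ k : ℝ) : ℂ)) -
      ∑' k : ℤ, f (zm * q ^ k) * (starRingEnd ℂ) (g (zm * q ^ k)) *
        w q a b c d (zm * q ^ k) * ((zm * q ^ k : ℝ) : ℂ))

/-- The squared `ℒ²`-norm. -/
def normSqL2 (q zm zp : ℝ) (a b c d : ℂ) (f : ℝ → ℂ) : ℝ :=
  (1 - q) *
    ((∑' k : ℤ, ‖f (zp * q ^ k)‖ ^ 2 * ‖w q a b c d (zp * q ^ k)‖ * (zp * q ^ k)) +
      ∑' k : ℤ, ‖f (zm * q ^ k)‖ ^ 2 * ‖w q a b c d (zm * q ^ k)‖ * (-(zm * q ^ k)))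

/-- The q-difference operator `D_q`. -/
def Dq (q : ℝ) (f : ℝ → ℂ) (x : ℝ) : ℂ := (f x - f (q * x)) / ((1 - (q : ℂ)) * (x : ℂ))

/-- The q-line `ℝ_q`. -/
def Rq (q zm zp : ℝ) : Set ℝ := {x | ∃ k : ℤ, x = zm * q ^ k ∨ x = zp * q ^ k}

/-- Membership in the domain `𝒟`. -/
def memD (q zm zp : ℝ) (a b c d : ℂ) (f : ℝ → ℂ) : Prop :=
  memL2 q zm zp a b c d f ∧ memL2 q zm zp a b c d (Lop q a b c d f) ∧
    (∃ v : ℂ, Tendsto (fun k : ℕ => f (zm * q ^ k)) atTop (nhds v) ∧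
        Tendsto (fun k : ℕ => f (zp * q ^ k)) atTop (nhds v)) ∧
    (∃ v : ℂ, Tendsto (fun k : ℕ => Dq q f (zm * q ^ k)) atTop (nhds v) ∧
        Tendsto (fun k : ℕ => Dq q f (zp * q ^ k)) atTop (nhds v))

/-- Membership in the eigenspace `V_μ` (functions on `ℝ_q`). -/
def memV (q zm zp : ℝ) (a b c d : ℂ) (μ : ℂ) (f : ℝ → ℂ) : Prop :=
  (∀ x ∈ Rq q zm zp, Lop q a b c d f x = μ * f x) ∧
    (∃ v : ℂ, Tendsto (fun k : ℕ => f (zm * q ^ k)) atTop (nhds v) ∧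
        Tendsto (fun k : ℕ => f (zp * q ^ k)) atTop (nhds v)) ∧
    (∃ v : ℂ, Tendsto (fun k : ℕ => Dq q f (zm * q ^ k)) atTop (nhds v) ∧
        Tendsto (fun k : ℕ => Dq q f (zp * q ^ k)) atTop (nhds v))

/-- The set of regular spectral values `S_reg = ℂ* \ {± q^{k/2}}`. -/
def Sreg (q : ℝ) (γ : ℂ) : Prop :=
  γ ≠ 0 ∧ ∀ k : ℤ, γ ≠ ((q ^ ((k : ℝ) / 2) : ℝ) : ℂ) ∧ γ ≠ -((q ^ ((k : ℝ) / 2) : ℝ) : ℂ)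

/-- The big q-Jacobi function `φ_γ(x)`. -/
def phi (q : ℝ) (a b c d : ℂ) (γ x : ℂ) : ℂ :=
  ∑' n : ℕ,
    pochN q (q / (a * x)) n * pochN q (sP q a b c d * γ) n * pochN q (sP q a b c d / γ) n /
      (pochN q q n * pochN q (c * q / a) n * pochN q (d * q / a) n) * (b * x) ^ n

/-- The asymptotic solution `Φ_γ(z q^{-k})`, in index form. -/
def PhiIdx (q : ℝ) (a b c d : ℂ) (γ : ℂ) (z : ℝ) (k : ℤ) : ℂ :=
  let s : ℂ := sP q a b c d
  let x : ℂ := (z : ℂ) * (q : ℂ) ^ (-k)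
  (s * γ) ^ k *
    (poch q ((q : ℂ) / (b * x)) * poch q ((q : ℂ) ^ 2 * γ / (a * s * x)) /
      (poch q ((q : ℂ) / (c * x)) * poch q ((q : ℂ) / (d * x)))) *
    ∑' n : ℕ,
      pochN q ((q : ℂ) * γ / s) n * pochN q (c * q * γ / (s * a)) n *
          pochN q (d * q * γ / (s * a)) n /
        (pochN q q n * pochN q ((q : ℂ) ^ 2 * γ / (a * s * x)) n * pochN q ((q : ℂ) * γ ^ 2) n) *
        ((q : ℂ) / (b * x)) ^ n

/-- Casorati determinant at `x = z q^{-k}` for index-form functions. -/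
def casDIdx (q : ℝ) (a b c d : ℂ) (f g : ℤ → ℂ) (z : ℝ) (k : ℤ) : ℂ :=
  (f k * g (k - 1) - f (k - 1) * g k) * u q a b c d (z * q ^ (-k)) /
    ((1 - (q : ℂ)) * ((z * q ^ (-k) : ℝ) : ℂ))

/-- The c-function `c_z(γ)`. -/
def cz (q : ℝ) (a b c d : ℂ) (z : ℝ) (γ : ℂ) : ℂ :=
  let s : ℂ := sP q a b c d
  poch q (s / γ) * poch q (c * q / (a * s * γ)) * poch q (d * q / (a * s * γ)) *
      theta q (b * s * z * γ) /
    (poch q (c * q / a) * poch q (d * q / a) * poch q (1 / γ ^ 2) * theta q (b * z))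

/-- The expansion coefficient `d_z(γ)`. -/
def dz (q : ℝ) (a b c d : ℂ) (z : ℝ) (γ : ℂ) : ℂ :=
  let s : ℂ := sP q a b c d
  (poch q (c * q / a) * poch q (d * q / a) * theta q (b * z) /
      (theta q (a / b) * theta q (c * z) * theta q (d * z))) *
    (poch q (c * q * γ / (s * b)) * poch q (d * q * γ / (s * b)) *
        theta q (a * s * z / (q * γ)) /
      (poch q (q * γ ^ 2) * poch q (s / γ)))

/-- The Casorati determinant `v(γ) = D(Φ_γ^+, Φ_γ^-)`. -/
def vFun (q zm zp : ℝ) (a b c d : ℂ) (γ : ℂ) : ℂ :=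
  let s : ℂ := sP q a b c d;
  -((zp : ℂ) * (1 - (q : ℂ)) * theta q ((zm : ℂ) / zp) /
      (theta q (c * zm) * theta q (d * zm) * theta q (c * zp) * theta q (d * zp))) *
    (poch q (c * q * γ / (a * s)) * poch q (d * q * γ / (a * s)) * poch q (c * q * γ / (b * s)) *
        poch q (d * q * γ / (b * s)) * poch q (s * γ) * poch q (q * γ / s) *
        theta q (a * b * s * zm * zp / (q * γ)) /
      (γ * (poch q (q * γ ^ 2)) ^ 2))

/-- The function `v₁(γ)` in the continuous part of the spectral measure. -/
def v1Fun (q zm zp : ℝ) (a b c d : ℂ) (γ : ℂ) : ℂ :=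
  let s : ℂ := sP q a b c d
  ((poch q (c * q / a)) ^ 2 * (poch q (d * q / a)) ^ 2 * theta q (b * zp) * theta q (b * zm) /
      ((1 - (q : ℂ)) * a * b * (zm : ℂ) ^ 2 * (zp : ℂ) ^ 2 *
        (theta q ((zm : ℂ) / zp) * theta q ((zp : ℂ) / zm) * theta q (a / b) * theta q (b / a)))) *
    (poch q (γ ^ 2) * poch q (γ⁻¹ ^ 2) /
      (poch q (s * γ) * poch q (s / γ) * poch q (c * q * γ / (a * s)) *
        poch q (c * q / (a * s * γ)) * poch q (d * q * γ / (a * s)) *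
        poch q (d * q / (a * s * γ)) *
        (theta q (s * γ) * theta q (s / γ) * theta q (a * b * s * zm * zp * γ) *
          theta q (a * b * s * zm * zp / γ)))) *
    ((zm : ℂ) * (theta q (a * zp) * theta q (c * zp) * theta q (d * zp) * theta q (b * zm) *
          theta q (a * s * zm * γ) * theta q (a * s * zm / γ)) -
      (zp : ℂ) * (theta q (a * zm) * theta q (c * zm) * theta q (d * zm) * theta q (b * zp) *
          theta q (a * s * zp * γ) * theta q (a * s * zp / γ)))

/-- The function `v₂(γ)` in the continuous part of the spectral measure. -/
def v2Fun (q zm zp : ℝ) (a b c d : ℂ) (γ : ℂ) : ℂ :=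
  let s : ℂ := sP q a b c d
  (poch q (c * q / a) * poch q (d * q / a) * poch q (c * q / b) * poch q (d * q / b) *
      (theta q (a * zp) * theta q (a * zm) * theta q (b * zp) * theta q (b * zm) *
        theta q (c * d * zm * zp)) /
      (a * b * (zm : ℂ) ^ 2 * (zp : ℂ) * (1 - (q : ℂ)) *
        (theta q ((zp : ℂ) / zm) * theta q (a / b) * theta q (b / a)))) *
    (poch q (γ ^ 2) * poch q (γ⁻¹ ^ 2) /
      (poch q (s * γ) * poch q (s / γ) *
        (theta q (s * γ) * theta q (s / γ) * theta q (a * b * s * zm * zp * γ) *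
          theta q (a * b * s * zm * zp / γ))))

/-- The function `u₁(γ)`. -/
def u1Fun (q zm zp : ℝ) (a b c d : ℂ) (γ : ℂ) : ℂ :=
  Kz q a b c d zp * cz q a b c d zp γ * cz q a b c d zp γ⁻¹ -
    Kz q a b c d zm * cz q a b c d zm γ * cz q a b c d zm γ⁻¹

/-- The function `u₂(γ)`. -/
def u2Fun (q zm zp : ℝ) (a b c d : ℂ) (γ : ℂ) : ℂ :=
  Kz q a b c d zp * cz q a b c d zp γ * cz q b a c d zp γ⁻¹ -
    Kz q a b c d zm * cz q a b c d zm γ * cz q b a c d zm γ⁻¹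

/-- The big q-Jacobi polynomial `P_k(y; α, β, δ; q)`. -/
def bigqJacobiP (q : ℝ) (α β δ : ℂ) (k : ℕ) (y : ℂ) : ℂ :=
  ∑ j ∈ Finset.range (k + 1),
    pochN q (((q : ℂ) ^ k)⁻¹) j * pochN q (α * β * (q : ℂ) ^ (k + 1)) j * pochN q y j /
      (pochN q q j * pochN q (α * q) j * pochN q (δ * q) j) * (q : ℂ) ^ j

section Theta

variable {q : ℂ}

lemma summable_norm_mul_pow (hq : ‖q‖ < 1) (x : ℂ) : Summable fun j : ℕ => ‖-(x * q ^ j)‖ := by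
  simpa [norm_mul, norm_pow] using
    (summable_geometric_of_lt_one (norm_nonneg q) hq).mul_left ‖x‖

lemma multipliable_one_sub_mul_pow (hq : ‖q‖ < 1) (x : ℂ) :
    Multipliable fun j : ℕ => (1 - x * q ^ j) := by
  simpa [sub_eq_add_neg] using multipliable_one_add_of_summable (summable_norm_mul_pow hq x)

lemma tendsto_pochN (hq : ‖q‖ < 1) (x : ℂ) :
    Tendsto (pochN q x) atTop (nhds (poch q x)) :=
  (multipliable_one_sub_mul_pow hq x).hasProd.tendsto_prod_nat

lemma poch_ne_zero (hq : ‖q‖ < 1) {x : ℂ} (hx : ∀ j : ℕ, x * q ^ j ≠ 1) : poch q x ≠ 0 := by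
  have := tprod_one_add_ne_zero_of_summable (f := fun j : ℕ => -(x * q ^ j))
    (fun j => by simpa [← sub_eq_add_neg, sub_eq_zero] using (hx j).symm)
    (summable_norm_mul_pow hq x)
  simpa [poch, sub_eq_add_neg] using this

lemma poch_eq_one_sub_mul (hq : ‖q‖ < 1) (x : ℂ) : poch q x = (1 - x) * poch q (q * x) := by
  have h := tprod_eq_zero_mul' (f := fun j : ℕ => (1 - x * q ^ j))
    ((multipliable_one_sub_mul_pow hq (q * x)).congr fun j => by ring)
  rw [poch, h, poch]
  congr 1
  · simp
  · exact tprod_congr fun j => by ring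

lemma pow_succ_ne_one (hq : ‖q‖ < 1) (j : ℕ) : q * q ^ j ≠ 1 := by
  intro h
  have h' : ‖q ^ (j + 1)‖ = 1 := by rw [pow_succ', h, norm_one]
  rw [norm_pow] at h'
  exact (pow_lt_one₀ (norm_nonneg q) hq (Nat.succ_ne_zero j)).ne h'

lemma pochN_self_ne_zero (hq : ‖q‖ < 1) (n : ℕ) : pochN q q n ≠ 0 :=
  Finset.prod_ne_zero_iff.2 fun j _ => sub_ne_zero.2 (pow_succ_ne_one hq j).symm

lemma pochN_succ (x : ℂ) (n : ℕ) : pochN q x (n + 1) = pochN q x n * (1 - x * q ^ n) :=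
  Finset.prod_range_succ _ _

lemma theta_div (hq0 : q ≠ 0) {x : ℂ} (hx : x ≠ 0) : theta q (q / x) = theta q x := by
  rw [theta, theta, mul_comm]
  congr 2
  field_simp

lemma theta_mul_left (hq : ‖q‖ < 1) (hq0 : q ≠ 0) {x : ℂ} (hx : x ≠ 0) :
    theta q (q * x) = -theta q x / x := by
  have e : q / (q * x) = 1 / x := by field_simp
  have e' : q * (1 / x) = q / x := by ring
  rw [theta, theta, e, poch_eq_one_sub_mul hq (1 / x), poch_eq_one_sub_mul hq x, e']
  field_simp
  ring

lemma theta_inv (hq : ‖q‖ < 1) (hq0 : q ≠ 0) {x : ℂ} (hx : x ≠ 0) :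
    theta q x⁻¹ = -theta q x / x := by
  rw [← theta_mul_left hq hq0 hx, ← theta_div hq0 (mul_ne_zero hq0 hx)]
  congr 1
  field_simp

lemma theta_ne_zero (hq : ‖q‖ < 1) (hq0 : q ≠ 0) {x : ℂ} (hx0 : x ≠ 0)
    (hx : ∀ k : ℤ, x ≠ q ^ k) : theta q x ≠ 0 := by
  refine mul_ne_zero (poch_ne_zero hq fun j h => hx (-j) ?_) (poch_ne_zero hq fun j h => ?_)
  · rw [zpow_neg, zpow_natCast]
    exact eq_inv_of_mul_eq_one_left h
  · refine hx (j + 1) ?_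
    rw [zpow_add_one₀ hq0, zpow_natCast]
    field_simp at h
    rw [← h, mul_comm]

/-- The coefficient `(-1)ⁿ q^{n(n-1)/2}` of the theta series. -/
def thetaCoef (q : ℂ) (n : ℤ) : ℂ := (-1) ^ n * q ^ (n * (n - 1) / 2)

lemma thetaCoef_add_one (hq0 : q ≠ 0) (n : ℤ) :
    thetaCoef q (n + 1) = -q ^ n * thetaCoef q n := by
  have e : (n + 1) * (n + 1 - 1) / 2 = n * (n - 1) / 2 + n := by
    rw [← Int.add_mul_ediv_right _ _ two_ne_zero]
    congr 1
    ring
  rw [thetaCoef, thetaCoef, e, zpow_add₀ hq0, zpow_add_one₀ (by norm_num)]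
  ring

lemma thetaCoef_ne_zero (hq0 : q ≠ 0) (n : ℤ) : thetaCoef q n ≠ 0 :=
  mul_ne_zero (zpow_ne_zero _ (by norm_num)) (zpow_ne_zero _ hq0)

lemma summable_norm_thetaCoef_mul_zpow (hq : ‖q‖ < 1) (hq0 : q ≠ 0) {x : ℂ} (hx : x ≠ 0) :
    Summable fun n : ℤ => ‖thetaCoef q n * x ^ n‖ := by
  have hpow : Tendsto (fun n : ℕ => ‖q‖ ^ n) atTop (nhds 0) :=
    tendsto_pow_atTop_nhds_zero_of_lt_one (norm_nonneg q) hq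
  have hne : ∀ n : ℤ, ‖thetaCoef q n * x ^ n‖ ≠ 0 := fun n =>
    norm_ne_zero_iff.2 (mul_ne_zero (thetaCoef_ne_zero hq0 n) (zpow_ne_zero _ hx))
  have hstep : ∀ n : ℤ, thetaCoef q (n + 1) * x ^ (n + 1)
      = -q ^ n * x * (thetaCoef q n * x ^ n) := fun n => by
    rw [thetaCoef_add_one hq0, zpow_add_one₀ hx]
    ring
  refine Summable.of_nat_of_neg_add_one ?_ ?_
  · refine summable_of_ratio_test_tendsto_lt_one (l := 0) zero_lt_one
      (Eventually.of_forall fun n => hne n) ?_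
    have : Tendsto (fun n : ℕ => ‖q‖ ^ n * ‖x‖) atTop (nhds 0) := by
      simpa using hpow.mul_const ‖x‖
    refine this.congr fun n => ?_
    have h := hstep n
    push_cast
    rw [norm_norm, norm_norm, h, norm_mul, mul_div_assoc, div_self (hne n)]
    simp
  · refine summable_of_ratio_test_tendsto_lt_one (l := 0) zero_lt_one
      (Eventually.of_forall fun n => hne _) ?_
    have : Tendsto (fun n : ℕ => ‖q‖ ^ n * (‖q‖ ^ 2 * ‖x‖⁻¹)) atTop (nhds 0) := by
      simpa using hpow.mul_const (‖q‖ ^ 2 * ‖x‖⁻¹)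
    refine this.congr fun n => ?_
    have h := hstep (-((n + 1 : ℕ) + 1 : ℤ))
    rw [show (-((n + 1 : ℕ) + 1 : ℤ) + 1) = -((n : ℤ) + 1) by push_cast; ring] at h
    rw [norm_norm, norm_norm, h, norm_mul (-q ^ _ * x), div_mul_cancel_right₀ (hne _)]
    have e : (-((n + 1 : ℕ) + 1 : ℤ)) = -((n + 2 : ℕ) : ℤ) := by push_cast; ring
    rw [e, norm_mul, norm_neg, zpow_neg, norm_inv, zpow_natCast, norm_pow, mul_inv, inv_inv]
    ring

/-- The reciprocal `1 / (q;q)_n`, extended by zero to negative `n`. -/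
def recipPoch (q : ℂ) : ℤ → ℂ
  | Int.ofNat n => (pochN q q n)⁻¹
  | Int.negSucc _ => 0

lemma recipPoch_sub_one (hq : ‖q‖ < 1) (n : ℤ) :
    recipPoch q (n - 1) = (1 - q ^ n) * recipPoch q n := by
  rcases n with (_ | n) | n
  · have e : Int.ofNat 0 - 1 = Int.negSucc 0 := rfl
    rw [e, recipPoch]
    simp [show recipPoch q (-1) = 0 from rfl]
  · have e : Int.ofNat (n + 1) - 1 = Int.ofNat n := by simp
    have h1 := pochN_self_ne_zero hq (n + 1)
    rw [e, recipPoch, recipPoch]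
    rw [pochN_succ] at h1 ⊢
    have := left_ne_zero_of_mul h1
    have := right_ne_zero_of_mul h1
    have e2 : q ^ (Int.ofNat (n + 1)) = q * q ^ n := by
      rw [Int.ofNat_eq_natCast, zpow_natCast, pow_succ']
    rw [e2]
    field_simp
  · have e : Int.negSucc n - 1 = Int.negSucc (n + 1) := rfl
    rw [e, recipPoch, recipPoch, mul_zero]

lemma poch_self_ne_zero (hq : ‖q‖ < 1) : poch q q ≠ 0 := poch_ne_zero hq (pow_succ_ne_one hq)

lemma tendsto_inv_pochN_self (hq : ‖q‖ < 1) :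
    Tendsto (fun n : ℕ => (pochN q q n)⁻¹) atTop (nhds (poch q q)⁻¹) :=
  (tendsto_pochN hq q).inv₀ (poch_self_ne_zero hq)

lemma exists_norm_recipPoch_le (hq : ‖q‖ < 1) : ∃ C, ∀ n : ℤ, ‖recipPoch q n‖ ≤ C := by
  obtain ⟨C, hC⟩ := (Metric.isBounded_range_of_tendsto _ (tendsto_inv_pochN_self hq)).exists_norm_le
  refine ⟨C, fun n => ?_⟩
  rcases n with n | n
  · exact hC _ ⟨n, rfl⟩
  · simpa [recipPoch] using (norm_nonneg _).trans (hC _ ⟨0, rfl⟩)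

lemma tendsto_recipPoch (hq : ‖q‖ < 1) (m : ℤ) :
    Tendsto (fun N : ℕ => recipPoch q (N + m)) atTop (nhds (poch q q)⁻¹) := by
  have h : Tendsto (fun N : ℕ => ((N : ℤ) + m).toNat) atTop atTop := by
    refine tendsto_atTop.2 fun b => ?_
    filter_upwards [eventually_ge_atTop (b + m.natAbs)] with N hN
    omega
  refine ((tendsto_inv_pochN_self hq).comp h).congr' ?_
  filter_upwards [eventually_ge_atTop m.natAbs] with N hN
  have e : (N : ℤ) + m = Int.ofNat ((N : ℤ) + m).toNat := by
    rw [Int.ofNat_eq_natCast]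
    omega
  rw [Function.comp, e, recipPoch]
  rfl

lemma recipPoch_mul_thetaCoef_succ (hq : ‖q‖ < 1) (hq0 : q ≠ 0) (N : ℕ) (n : ℤ) :
    pochN q q (2 * (N + 1)) * recipPoch q (N + 1 + n) * recipPoch q (N + 1 - n) * thetaCoef q n =
      (1 + q ^ (2 * N + 1)) *
          (pochN q q (2 * N) * recipPoch q (N + n) * recipPoch q (N - n) * thetaCoef q n) -
        q ^ N * (pochN q q (2 * N) * recipPoch q (N + (n - 1)) * recipPoch q (N - (n - 1)) *
          thetaCoef q (n - 1)) -
        q ^ (N + 1) * (pochN q q (2 * N) * recipPoch q (N + (n + 1)) *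
          recipPoch q (N - (n + 1)) * thetaCoef q (n + 1)) := by
  have r1 := recipPoch_sub_one hq (N + 1 + n)
  have r2 := recipPoch_sub_one hq (N + 1 - n)
  have r3 := recipPoch_sub_one hq (N + n)
  have r4 := recipPoch_sub_one hq (N - n)
  have g1 := thetaCoef_add_one hq0 (n - 1)
  have g2 := thetaCoef_add_one hq0 n
  rw [sub_add_cancel] at g1
  rw [show (N : ℤ) + 1 + n - 1 = N + n by ring] at r1
  rw [show (N : ℤ) + 1 - n - 1 = N - n by ring] at r2
  rw [show (N : ℤ) + (n - 1) = N + n - 1 by ring, show (N : ℤ) - (n - 1) = N + 1 - n by ring,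
    show (N : ℤ) + (n + 1) = N + 1 + n by ring, show (N : ℤ) - (n + 1) = N - n - 1 by ring,
    r3, r4, r1, r2, g2, g1, show 2 * (N + 1) = 2 * N + 1 + 1 by ring, pochN_succ, pochN_succ]
  simp only [zpow_add₀ hq0, zpow_sub₀ hq0, zpow_natCast, zpow_one, pow_succ, pow_mul']
  have ht := zpow_ne_zero n hq0
  generalize q ^ n = t at ht ⊢
  generalize pochN q q (2 * N) = A
  generalize recipPoch q (N + 1 + n) = B
  generalize recipPoch q (N + 1 - n) = C
  generalize thetaCoef q (n - 1) = D
  generalize q ^ N = E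
  field_simp
  ring

lemma hasSum_pochN_mul_pochN (hq : ‖q‖ < 1) (hq0 : q ≠ 0) {x : ℂ} (hx : x ≠ 0) (N : ℕ) :
    HasSum (fun n : ℤ => pochN q q (2 * N) * recipPoch q (N + n) * recipPoch q (N - n) *
      (thetaCoef q n * x ^ n)) (pochN q x N * pochN q (q / x) N) := by
  induction N with
  | zero =>
    have h := hasSum_single (f := fun n : ℤ => pochN q q (2 * 0) * recipPoch q ((0 : ℕ) + n) *
      recipPoch q ((0 : ℕ) - n) * (thetaCoef q n * x ^ n)) 0 ?_
    · simpa [pochN, recipPoch, thetaCoef, show recipPoch q 0 = (pochN q q 0)⁻¹ from rfl] using h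
    · intro n hn
      rcases n with (_ | n) | n
      · exact absurd rfl hn
      · have : ((0 : ℕ) : ℤ) - Int.ofNat (n + 1) = Int.negSucc n := by simp [Int.negSucc_eq]
        simp only [this, recipPoch, mul_zero, zero_mul]
      · have : ((0 : ℕ) : ℤ) + Int.negSucc n = Int.negSucc n := by simp
        simp only [this, recipPoch, mul_zero, zero_mul]
  | succ N ih =>
    obtain ⟨f, hf⟩ : ∃ f : ℤ → ℂ, f = fun n => pochN q q (2 * N) * recipPoch q (N + n) *
      recipPoch q (N - n) * (thetaCoef q n * x ^ n) := ⟨_, rfl⟩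
    rw [← hf] at ih
    have hs1 : HasSum (fun n => f (n - 1)) (pochN q x N * pochN q (q / x) N) :=
      ((Equiv.subRight (1 : ℤ)).hasSum_iff (f := f)).2 ih
    have hs2 : HasSum (fun n => f (n + 1)) (pochN q x N * pochN q (q / x) N) :=
      ((Equiv.addRight (1 : ℤ)).hasSum_iff (f := f)).2 ih
    have key := ((ih.mul_left (1 + q ^ (2 * N + 1))).sub (hs1.mul_left (q ^ N * x))).sub
      (hs2.mul_left (q ^ (N + 1) / x))
    convert key using 1
    · rfl
    · funext n
      have h := recipPoch_mul_thetaCoef_succ hq hq0 N n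
      have e : ((N + 1 : ℕ) : ℤ) = N + 1 := by push_cast; rfl
      simp only [hf, e, zpow_sub_one₀ hx, zpow_add_one₀ hx]
      generalize thetaCoef q (n - 1) = g₁ at h ⊢
      generalize thetaCoef q (n + 1) = g₂ at h ⊢
      rw [← mul_assoc, h, div_eq_mul_inv]
      have hxx := mul_inv_cancel₀ hx
      generalize x⁻¹ = y at hxx ⊢
      linear_combination (q ^ N * (pochN q q (2 * N) * recipPoch q (N + (n - 1)) *
        recipPoch q (N - (n - 1)) * g₁) + q ^ (N + 1) * (pochN q q (2 * N) *
        recipPoch q (N + (n + 1)) * recipPoch q (N - (n + 1)) * g₂)) * x ^ n * hxx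
    · rw [pochN_succ, pochN_succ]
      field_simp
      ring

/-- The Jacobi triple product identity. -/
theorem hasSum_theta (hq : ‖q‖ < 1) (hq0 : q ≠ 0) {x : ℂ} (hx : x ≠ 0) :
    HasSum (fun n : ℤ => (poch q q)⁻¹ * (thetaCoef q n * x ^ n)) (theta q x) := by
  have hs := (summable_norm_thetaCoef_mul_zpow hq hq0 hx)
  obtain ⟨C, hC⟩ := exists_norm_recipPoch_le hq
  have hC0 : 0 ≤ C := (norm_nonneg _).trans (hC 0)
  have hpoch : Tendsto (fun N : ℕ => pochN q q (2 * N)) atTop (nhds (poch q q)) :=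
    (tendsto_pochN hq q).comp (tendsto_id.const_mul_atTop' two_pos)
  obtain ⟨D, hD⟩ := (Metric.isBounded_range_of_tendsto _ hpoch).exists_norm_le
  have hlim := tendsto_tsum_of_dominated_convergence (𝓕 := atTop)
    (f := fun (N : ℕ) (n : ℤ) => pochN q q (2 * N) * recipPoch q (N + n) * recipPoch q (N - n) *
      (thetaCoef q n * x ^ n))
    (g := fun n : ℤ => (poch q q)⁻¹ * (thetaCoef q n * x ^ n))
    (bound := fun n : ℤ => D * C * C * ‖thetaCoef q n * x ^ n‖) (hs.mul_left _)
    (fun n => by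
      have h := (((hpoch.mul (tendsto_recipPoch hq n)).mul (tendsto_recipPoch hq (-n))).mul_const
        (thetaCoef q n * x ^ n))
      rw [mul_inv_cancel₀ (poch_self_ne_zero hq), one_mul] at h
      simpa only [sub_eq_add_neg] using h)
    (Eventually.of_forall fun N n => by
      have h1 := hD _ ⟨N, rfl⟩
      have hD0 : 0 ≤ D := (norm_nonneg _).trans h1
      rw [norm_mul, norm_mul, norm_mul]
      exact mul_le_mul_of_nonneg_right (mul_le_mul (mul_le_mul h1 (hC _) (norm_nonneg _) hD0)
        (hC _) (norm_nonneg _) (mul_nonneg hD0 hC0)) (norm_nonneg _))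
  have h2 : Tendsto (fun N : ℕ => pochN q x N * pochN q (q / x) N) atTop (nhds (theta q x)) :=
    (tendsto_pochN hq x).mul (tendsto_pochN hq (q / x))
  have h3 := tendsto_nhds_unique
    (hlim.congr fun N => (hasSum_pochN_mul_pochN hq hq0 hx N).tsum_eq) h2
  rw [← h3]
  exact (hs.of_norm.mul_left _).hasSum

/-- The coefficient of `x ^ p`, up to a scalar, in the expansion of `θ(xy) θ(x/y)`. -/
def thetaMulCoef (q : ℂ) (p : ℤ) (y : ℂ) : ℂ :=
  ∑' m : ℤ, thetaCoef q m * thetaCoef q (p - m) * y ^ (2 * m - p)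

lemma thetaMulCoef_add_two (hq0 : q ≠ 0) (p : ℤ) (y : ℂ) :
    thetaMulCoef q (p + 2) y = q ^ p * thetaMulCoef q p y := by
  rw [thetaMulCoef, ← (Equiv.addRight (1 : ℤ)).tsum_eq, thetaMulCoef, ← tsum_mul_left]
  refine tsum_congr fun m => ?_
  rw [Equiv.coe_addRight, show p + 2 - (m + 1) = p - m + 1 by ring,
    show 2 * (m + 1) - (p + 2) = 2 * m - p by ring, thetaCoef_add_one hq0, thetaCoef_add_one hq0,
    zpow_sub₀ hq0]
  have := zpow_ne_zero m hq0
  field_simp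

lemma thetaMulCoef_combination_eq_zero (hq0 : q ≠ 0) {ι : Type*} [Fintype ι] (l y : ι → ℂ)
    (h0 : ∑ i, l i * thetaMulCoef q 0 (y i) = 0) (h1 : ∑ i, l i * thetaMulCoef q 1 (y i) = 0)
    (p : ℤ) : ∑ i, l i * thetaMulCoef q p (y i) = 0 := by
  have hstep : ∀ p : ℤ, ∑ i, l i * thetaMulCoef q (p + 2) (y i)
      = q ^ p * ∑ i, l i * thetaMulCoef q p (y i) := fun p => by
    rw [Finset.mul_sum]
    refine Finset.sum_congr rfl fun i _ => ?_
    rw [thetaMulCoef_add_two hq0]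
    ring
  have hpair : ∀ p : ℤ, ∑ i, l i * thetaMulCoef q p (y i) = 0 ∧
      ∑ i, l i * thetaMulCoef q (p + 1) (y i) = 0 := fun p => by
    induction p with
    | zero => exact ⟨h0, h1⟩
    | succ n ih => exact ⟨ih.2, by rw [add_assoc, one_add_one_eq_two, hstep, ih.1, mul_zero]⟩
    | pred n ih =>
      have h := hstep (-n - 1)
      rw [show (-(n : ℤ) - 1 + 2) = -n + 1 by ring, ih.2] at h
      exact ⟨(mul_eq_zero.1 h.symm).resolve_left (zpow_ne_zero _ hq0),
        by rw [sub_add_cancel]; exact ih.1⟩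
  exact (hpair p).1

lemma hasSum_theta_mul_theta (hq : ‖q‖ < 1) (hq0 : q ≠ 0) {x y : ℂ} (hx : x ≠ 0) (hy : y ≠ 0) :
    HasSum (fun p : ℤ => (poch q q)⁻¹ ^ 2 * x ^ p * thetaMulCoef q p y)
      (theta q (x * y) * theta q (x / y)) := by
  have hxy := mul_ne_zero hx hy
  have hxy' := div_ne_zero hx hy
  have hs := summable_mul_of_summable_norm
    ((summable_norm_thetaCoef_mul_zpow hq hq0 hxy).mul_left ‖(poch q q)⁻¹‖ |>.congr
      fun n => (norm_mul _ _).symm)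
    ((summable_norm_thetaCoef_mul_zpow hq hq0 hxy').mul_left ‖(poch q q)⁻¹‖ |>.congr
      fun n => (norm_mul _ _).symm)
  have h := (hasSum_theta hq hq0 hxy).mul (hasSum_theta hq hq0 hxy') hs
  let e : ℤ × ℤ ≃ ℤ × ℤ :=
    { toFun := fun r => (r.2, r.1 - r.2)
      invFun := fun r => (r.1 + r.2, r.1)
      left_inv := fun r => by ext <;> simp
      right_inv := fun r => by ext <;> simp }
  have h' := (e.hasSum_iff).2 h
  refine (h'.prod_fiberwise fun p => (h'.summable.prod_factor p).hasSum).congr_fun ?_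
  intro p
  rw [thetaMulCoef, ← tsum_mul_left]
  refine tsum_congr fun m => ?_
  simp only [Function.comp, e, Equiv.coe_fn_mk]
  rw [mul_zpow, div_zpow, zpow_sub₀ hx, zpow_sub₀ hy, zpow_sub₀ hy, two_mul, zpow_add₀ hy]
  have := zpow_ne_zero m hx
  have := zpow_ne_zero m hy
  have := zpow_ne_zero p hy
  field_simp

lemma theta_pair_swap (hq : ‖q‖ < 1) (hq0 : q ≠ 0) {x y : ℂ} (hx : x ≠ 0) (hy : y ≠ 0) :
    x⁻¹ * (theta q (x * y) * theta q (x / y)) = -(y⁻¹ * (theta q (y * x) * theta q (y / x))) := by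
  rw [← inv_div x y, theta_inv hq hq0 (div_ne_zero hx hy), mul_comm y x]
  field_simp

/-- The Weierstrass three-term theta identity. -/
theorem theta_weierstrass (hq : ‖q‖ < 1) (hq0 : q ≠ 0) {x y u v : ℂ} (hx : x ≠ 0) (hy : y ≠ 0)
    (hu : u ≠ 0) (hv : v ≠ 0) :
    y * (theta q (x * y) * theta q (x / y) * (theta q (u * v) * theta q (u / v))) -
      y * (theta q (x * v) * theta q (x / v) * (theta q (u * y) * theta q (u / y))) =
      u * (theta q (x * u) * theta q (x / u) * (theta q (y * v) * theta q (y / v))) := by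
  obtain ⟨z, hz⟩ : ∃ z : Fin 4 → ℂ, z = ![x, y, u, v] := ⟨_, rfl⟩
  have hz0 : ∀ i, z i ≠ 0 := by
    intro i
    fin_cases i <;> simp [hz, hx, hy, hu, hv]
  obtain ⟨K, hK⟩ : ∃ K : Fin 4 → Fin 4 → ℂ,
      K = fun i j => (z i)⁻¹ * (theta q (z i * z j) * theta q (z i / z j)) := ⟨_, rfl⟩
  have hanti : ∀ i j, K i j = -K j i := fun i j => by
    simp only [hK]
    exact theta_pair_swap hq hq0 (hz0 i) (hz0 j)
  let M : Matrix (Fin 2) (Fin 4) ℂ :=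
    Matrix.of fun i j => thetaMulCoef q ((i : ℕ) : ℤ) (z j)
  obtain ⟨l, hl, hl0⟩ := (Submodule.ne_bot_iff _).1
    (LinearMap.ker_ne_bot_of_finrank_lt (f := M.mulVecLin) (by simp))
  have hMl : ∀ i, ∑ j, l j * thetaMulCoef q ((i : Fin 2) : ℕ) (z j) = 0 := fun i => by
    have := congrFun (LinearMap.mem_ker.1 hl) i
    simpa [M, Matrix.mulVec, dotProduct, mul_comm] using this
  have hKl : ∀ i, ∑ j, l j * K i j = 0 := fun i => by
    have h := hasSum_sum fun j (_ : j ∈ Finset.univ) =>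
      (hasSum_theta_mul_theta hq hq0 (hz0 i) (hz0 j)).mul_left (l j * (z i)⁻¹)
    have h' : ∀ p : ℤ, ∑ j, l j * (z i)⁻¹ *
        ((poch q q)⁻¹ ^ 2 * z i ^ p * thetaMulCoef q p (z j)) = 0 := fun p => by
      have := thetaMulCoef_combination_eq_zero hq0 l z (by simpa using hMl 0)
        (by simpa using hMl 1) p
      rw [← mul_zero ((z i)⁻¹ * ((poch q q)⁻¹ ^ 2 * z i ^ p)), ← this, Finset.mul_sum]
      exact Finset.sum_congr rfl fun j _ => by ring
    simp only [h'] at h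
    rw [← h.unique hasSum_zero]
    exact Finset.sum_congr rfl fun j _ => by rw [hK]; ring
  have hpf : K 0 1 * K 2 3 - K 0 2 * K 1 3 + K 0 3 * K 1 2 = 0 := by
    obtain ⟨i, hi⟩ := Function.ne_iff.1 hl0
    have hd : ∀ i, K i i = 0 := fun i => self_eq_neg.1 (hanti i i)
    have e0 := hKl 0
    have e1 := hKl 1
    have e2 := hKl 2
    have e3 := hKl 3
    simp only [Fin.sum_univ_four, hd, hanti 1 0, hanti 2 0, hanti 3 0, hanti 2 1, hanti 3 1,
      hanti 3 2] at e0 e1 e2 e3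
    refine (mul_eq_zero.1 ?_).resolve_left hi
    fin_cases i <;> simp only [Fin.zero_eta, Fin.mk_one, Fin.reduceFinMk]
    · linear_combination -K 2 3 * e1 + K 1 3 * e2 - K 1 2 * e3
    · linear_combination K 2 3 * e0 - K 0 3 * e2 + K 0 2 * e3
    · linear_combination -K 1 3 * e0 + K 0 3 * e1 - K 0 1 * e3
    · linear_combination K 1 2 * e0 - K 0 2 * e1 + K 0 1 * e2
  rw [hanti 1 2, show K 0 1 = x⁻¹ * (theta q (x * y) * theta q (x / y)) by simp [hK, hz],
    show K 0 2 = x⁻¹ * (theta q (x * u) * theta q (x / u)) by simp [hK, hz],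
    show K 0 3 = x⁻¹ * (theta q (x * v) * theta q (x / v)) by simp [hK, hz],
    show K 2 3 = u⁻¹ * (theta q (u * v) * theta q (u / v)) by simp [hK, hz],
    show K 1 3 = y⁻¹ * (theta q (y * v) * theta q (y / v)) by simp [hK, hz],
    show K 2 1 = u⁻¹ * (theta q (u * y) * theta q (u / y)) by simp [hK, hz]] at hpf
  field_simp at hpf
  rw [mul_comm y u] at hpf
  linear_combination hpf

lemma theta_sub_eq_of_mul_sq_eq (hq : ‖q‖ < 1) (hq0 : q ≠ 0) {a b c d s z w γ : ℂ} (ha : a ≠ 0)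
    (hb : b ≠ 0) (hc : c ≠ 0) (hd : d ≠ 0) (hs0 : s ≠ 0) (hz : z ≠ 0) (hw : w ≠ 0) (hγ : γ ≠ 0)
    (hs : a * b * s ^ 2 = c * d * q) :
    z * (theta q (b * s * z * γ) * theta q (a * s * z / γ) *
        (theta q (c * w) * theta q (d * w))) -
      w * (theta q (b * s * w * γ) * theta q (a * s * w / γ) *
        (theta q (c * z) * theta q (d * z))) =
      -(w * theta q (c * d * w * z) * theta q (z / w) *
        (theta q (c * q * γ / (a * s)) * theta q (d * q * γ / (a * s)))) := by
  obtain ⟨E, hE⟩ := IsAlgClosed.exists_pow_nat_eq (c * d * q) two_pos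
  have hE0 : E ≠ 0 := by
    rintro rfl
    simp [eq_comm, hc, hd, hq0] at hE
  have hEs : E ^ 2 = a * b * s ^ 2 := by rw [hE, hs]
  have h := theta_weierstrass hq hq0 (x := E * z) (y := b * s * γ / E) (u := E * w)
    (v := q * c / E) (by simp [*]) (by simp [*]) (by simp [*]) (by simp [*])
  rw [show E * z * (b * s * γ / E) = b * s * z * γ by field_simp,
    show E * w * (b * s * γ / E) = b * s * w * γ by field_simp,
    show E * z * (q * c / E) = q * (c * z) by field_simp,
    show E * w * (q * c / E) = q * (c * w) by field_simp,
    show E * z / (E * w) = z / w by field_simp,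
    show E * z / (b * s * γ / E) = a * s * z / γ by field_simp; rw [hEs]; field_simp,
    show E * w / (b * s * γ / E) = a * s * w / γ by field_simp; rw [hEs]; field_simp,
    show E * z / (q * c / E) = d * z by field_simp; rw [hE]; field_simp,
    show E * w / (q * c / E) = d * w by field_simp; rw [hE]; field_simp,
    show E * z * (E * w) = q * (c * d * w * z) by linear_combination (z * w) * hE,
    show b * s * γ / E * (q * c / E) = c * q * γ / (a * s) by
      field_simp; rw [hEs]; ring,
    show b * s * γ / E / (q * c / E) = d * γ / (a * s) by
      field_simp; linear_combination hs,
    theta_mul_left hq hq0 (by simp [*]), theta_mul_left hq hq0 (by simp [*]),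
    theta_mul_left hq hq0 (by simp [*])] at h
  have hd' := theta_mul_left hq hq0 (x := d * γ / (a * s)) (by simp [*])
  rw [show q * (d * γ / (a * s)) = d * q * γ / (a * s) by ring] at hd'
  rw [hd']
  field_simp at h ⊢
  rw [hEs] at h
  refine mul_left_cancel₀ (mul_ne_zero hb hs0) ?_
  linear_combination -h

lemma theta_sub_eq_mul_theta_mul (hq : ‖q‖ < 1) (hq0 : q ≠ 0) {a b s z w γ : ℂ} (ha : a ≠ 0)
    (hb : b ≠ 0) (hs0 : s ≠ 0) (hz : z ≠ 0) (hw : w ≠ 0) (hγ : γ ≠ 0) :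
    theta q (b * s * z * γ) * theta q (a * z) * (theta q (b * w) * theta q (a * s * w * γ)) -
      theta q (b * z) * theta q (a * s * z * γ) * (theta q (b * s * w * γ) * theta q (a * w)) =
      a * w * (theta q (a * b * s * w * z * γ) * theta q (z / w) *
        (theta q (b / a) * theta q (s * γ))) := by
  obtain ⟨E, hE⟩ := IsAlgClosed.exists_pow_nat_eq (a * b * s * γ) two_pos
  have hE0 : E ≠ 0 := by
    rintro rfl
    simp [eq_comm, ha, hb, hs0, hγ] at hE
  have h := theta_weierstrass hq hq0 (x := E * z) (y := b * s * γ / E) (u := E * w)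
    (v := b / E) (by simp [*]) (by simp [*]) (by simp [*]) (by simp [*])
  rw [show E * z * (b * s * γ / E) = b * s * z * γ by field_simp,
    show E * w * (b * s * γ / E) = b * s * w * γ by field_simp,
    show E * z * (b / E) = b * z by field_simp,
    show E * w * (b / E) = b * w by field_simp,
    show E * z / (E * w) = z / w by field_simp,
    show E * z / (b * s * γ / E) = a * z by field_simp; rw [hE]; ring,
    show E * w / (b * s * γ / E) = a * w by field_simp; rw [hE]; ring,
    show E * z / (b / E) = a * s * z * γ by field_simp; rw [hE]; ring,
    show E * w / (b / E) = a * s * w * γ by field_simp; rw [hE]; ring,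
    show E * z * (E * w) = a * b * s * w * z * γ by linear_combination (z * w) * hE,
    show b * s * γ / E * (b / E) = b / a by field_simp; rw [hE]; field_simp,
    show b * s * γ / E / (b / E) = s * γ by field_simp] at h
  have hu : E * w = b * s * γ / E * (a * w) := by field_simp; linear_combination hE
  rw [hu] at h
  refine mul_left_cancel₀ (show b * s * γ / E ≠ 0 by simp [*]) ?_
  linear_combination h

end Theta

section Inverse

/-- `x` is a nonzero number that is not an integral power of `q`. -/
def OffLattice (q x : ℂ) : Prop := x ≠ 0 ∧ ∀ k : ℤ, x ≠ q ^ k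

variable {q a b c d s z w γ : ℂ}

lemma OffLattice.theta_ne_zero {x : ℂ} (h : OffLattice q x) (hq : ‖q‖ < 1) (hq0 : q ≠ 0) :
    theta q x ≠ 0 := VVBQJ.theta_ne_zero hq hq0 h.1 h.2

lemma OffLattice.poch_ne_zero {x : ℂ} (h : OffLattice q x) (hq : ‖q‖ < 1) (hq0 : q ≠ 0) :
    poch q x ≠ 0 := left_ne_zero_of_mul (h.theta_ne_zero hq hq0)

lemma OffLattice.inv {x : ℂ} (h : OffLattice q x) : OffLattice q x⁻¹ :=
  ⟨inv_ne_zero h.1, fun k hk => h.2 (-k) (by rw [zpow_neg, ← hk, inv_inv])⟩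

lemma OffLattice.mul_base {x : ℂ} (h : OffLattice q x) (hq0 : q ≠ 0) : OffLattice q (x * q) :=
  ⟨mul_ne_zero h.1 hq0, fun k hk => h.2 (k - 1) (by
    rw [zpow_sub_one₀ hq0, ← hk, mul_inv_cancel_right₀ hq0])⟩

/-- The genericity conditions under which all denominators in `u(γ)` and `v(γ)` are nonzero. -/
structure Regular (q a b c d s z w γ : ℂ) : Prop where
  norm_lt : ‖q‖ < 1
  q0 : q ≠ 0
  a0 : a ≠ 0
  b0 : b ≠ 0
  c0 : c ≠ 0
  d0 : d ≠ 0
  s0 : s ≠ 0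
  z0 : z ≠ 0
  w0 : w ≠ 0
  γ0 : γ ≠ 0
  mul_sq : a * b * s ^ 2 = c * d * q
  ab : OffLattice q (a / b)
  zw : OffLattice q (z / w)
  az : OffLattice q (a * z)
  aw : OffLattice q (a * w)
  bz : OffLattice q (b * z)
  bw : OffLattice q (b * w)
  cz : OffLattice q (c * z)
  cw : OffLattice q (c * w)
  dz : OffLattice q (d * z)
  dw : OffLattice q (d * w)
  ca : OffLattice q (c * q / a)
  da : OffLattice q (d * q / a)
  cb : OffLattice q (c * q / b)
  db : OffLattice q (d * q / b)
  γsq : OffLattice q (γ ^ 2)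
  sγ : OffLattice q (s * γ)
  sγ' : OffLattice q (s / γ)
  abγ : OffLattice q (a * b * s * w * z * γ)
  abγ' : OffLattice q (a * b * s * w * z / γ)
  caγ : OffLattice q (c * q * γ / (a * s))
  daγ : OffLattice q (d * q * γ / (a * s))
  cbγ : OffLattice q (c * q * γ / (b * s))
  dbγ : OffLattice q (d * q * γ / (b * s))

/-- The numerator of `u₁(γ)` over a common denominator. -/
def u1Num (q a b c d s z w γ : ℂ) : ℂ :=
  z * (theta q (a * z) * theta q (c * w) * theta q (d * w) * theta q (b * w) *
      theta q (b * s * z * γ) * theta q (b * s * z / γ)) -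
    w * (theta q (a * w) * theta q (c * z) * theta q (d * z) * theta q (b * z) *
      theta q (b * s * w * γ) * theta q (b * s * w / γ))

lemma Regular.theta_mul_theta (h : Regular q a b c d s z w γ) :
    theta q (c * q * γ / (a * s)) * theta q (d * q * γ / (a * s)) =
      poch q (c * q * γ / (a * s)) * poch q (d * q * γ / (a * s)) *
        (poch q (c * q / (b * s * γ)) * poch q (d * q / (b * s * γ))) := by
  have := h.a0; have := h.b0; have := h.c0; have := h.d0; have := h.s0; have := h.γ0
  have := h.q0
  rw [theta, theta, show q / (c * q * γ / (a * s)) = d * q / (b * s * γ) by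
      field_simp; linear_combination h.mul_sq,
    show q / (d * q * γ / (a * s)) = c * q / (b * s * γ) by
      field_simp; linear_combination h.mul_sq]
  ring

lemma Regular.theta_inv_ratio (h : Regular q a b c d s z w γ) :
    theta q (w / z) = -theta q (z / w) * w / z := by
  have := h.z0; have := h.w0
  rw [show w / z = (z / w)⁻¹ by simp, theta_inv h.norm_lt h.q0 h.zw.1]
  field_simp

lemma Regular.theta_inv_ratio' (h : Regular q a b c d s z w γ) :
    theta q (b / a) = -theta q (a / b) * b / a := by
  have := h.a0; have := h.b0
  rw [show b / a = (a / b)⁻¹ by simp, theta_inv h.norm_lt h.q0 h.ab.1]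
  field_simp

lemma Regular.cd_div (h : Regular q a b c d s z w γ) :
    OffLattice q (c * q / (a * s * γ)) ∧ OffLattice q (d * q / (a * s * γ)) := by
  have := h.a0; have := h.b0; have := h.c0; have := h.d0; have := h.s0; have := h.γ0
  have := h.q0
  constructor
  · convert h.dbγ.inv.mul_base h.q0 using 1
    field_simp
    linear_combination -h.mul_sq
  · convert h.cbγ.inv.mul_base h.q0 using 1
    field_simp
    linear_combination -h.mul_sq

lemma Regular.γsq_inv (h : Regular q a b c d s z w γ) : OffLattice q (γ⁻¹ ^ 2) := by
  simpa using h.γsq.inv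

lemma Regular.swap (h : Regular q a b c d s z w γ) : Regular q b a c d s z w γ where
  __ := h
  a0 := h.b0
  b0 := h.a0
  mul_sq := by rw [mul_comm b a, h.mul_sq]
  ab := by simpa using h.ab.inv
  az := h.bz
  aw := h.bw
  bz := h.az
  bw := h.aw
  ca := h.cb
  da := h.db
  cb := h.ca
  db := h.da
  abγ := by simpa only [mul_comm b a] using h.abγ
  abγ' := by simpa only [mul_comm b a] using h.abγ'
  caγ := h.cbγ
  daγ := h.dbγ
  cbγ := h.caγ
  dbγ := h.daγ

lemma Regular.u1Num_mul_u1Num (h : Regular q a b c d s z w γ) :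
    theta q (a * z) * theta q (a * w) * theta q (b * z) * theta q (b * w) *
        (w * theta q (c * d * w * z) * theta q (z / w)) ^ 2 *
        (poch q (c * q * γ / (a * s)) * poch q (d * q * γ / (a * s)) *
          (poch q (c * q / (b * s * γ)) * poch q (d * q / (b * s * γ))) *
          (poch q (c * q * γ / (b * s)) * poch q (d * q * γ / (b * s)) *
          (poch q (c * q / (a * s * γ)) * poch q (d * q / (a * s * γ))))) -
      u1Num q a b c d s z w γ * u1Num q b a c d s z w γ =
    z * w * (theta q (c * z) * theta q (c * w) * theta q (d * z) * theta q (d * w)) *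
      (a * w * theta q (z / w) * theta q (b / a)) ^ 2 *
      (theta q (a * b * s * w * z * γ) * theta q (a * b * s * w * z / γ) *
        (theta q (s * γ) * theta q (s / γ))) := by
  have hA := theta_sub_eq_of_mul_sq_eq h.norm_lt h.q0 h.a0 h.b0 h.c0 h.d0 h.s0 h.z0 h.w0 h.γ0
    h.mul_sq
  have hA' := theta_sub_eq_of_mul_sq_eq h.norm_lt h.q0 h.b0 h.a0 h.c0 h.d0 h.s0 h.z0 h.w0 h.γ0
    h.swap.mul_sq
  have hB := theta_sub_eq_mul_theta_mul h.norm_lt h.q0 h.a0 h.b0 h.s0 h.z0 h.w0 h.γ0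
  have hB' := theta_sub_eq_mul_theta_mul h.norm_lt h.q0 h.a0 h.b0 h.s0 h.z0 h.w0
    (inv_ne_zero h.γ0)
  simp only [← div_eq_mul_inv] at hB'
  rw [h.theta_mul_theta] at hA
  rw [h.swap.theta_mul_theta] at hA'
  have hAA := congrArg₂ (· * ·) hA hA'
  have hBB := congrArg₂ (· * ·) hB hB'
  simp only [u1Num]
  linear_combination
    -(theta q (a * z) * theta q (a * w) * theta q (b * z) * theta q (b * w)) * hAA +
    z * w * (theta q (c * z) * theta q (c * w) * theta q (d * z) * theta q (d * w)) * hBB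

end Inverse

section Matrices

variable {q zm zp : ℝ} {a b c d γ : ℂ}

lemma sP_swap : sP q b a c d = sP q a b c d := by rw [sP, sP, mul_comm b a]

lemma u1Fun_eq (h : Regular (q : ℂ) a b c d (sP q a b c d) zp zm γ) :
    u1Fun q zm zp a b c d γ =
      poch q (sP q a b c d * γ) * poch q (sP q a b c d / γ) *
          (poch q (c * q * γ / (a * sP q a b c d)) * poch q (d * q * γ / (a * sP q a b c d)) *
            (poch q (c * q / (a * sP q a b c d * γ)) * poch q (d * q / (a * sP q a b c d * γ)))) *
          (1 - q) / ((poch q (c * q / a) * poch q (d * q / a)) ^ 2 *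
            (poch q (γ ^ 2) * poch q (γ⁻¹ ^ 2))) *
        (u1Num q a b c d (sP q a b c d) zp zm γ /
          (theta q (b * zp) * theta q (b * zm) * theta q (c * zp) * theta q (c * zm) *
            theta q (d * zp) * theta q (d * zm))) := by
  simp only [u1Fun, Kz, cz, u1Num]
  generalize sP q a b c d = s at *
  have e1 : 1 / γ ^ 2 = γ⁻¹ ^ 2 := by simp
  have e2 : 1 / γ⁻¹ ^ 2 = γ ^ 2 := by simp
  have e3 : ∀ x : ℂ, x / γ⁻¹ = x * γ := fun x => by simp
  simp only [e1, e2, e3, ← div_eq_mul_inv, div_div_eq_mul_div]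
  have := h.bz.theta_ne_zero h.norm_lt h.q0
  have := h.bw.theta_ne_zero h.norm_lt h.q0
  have := h.cz.theta_ne_zero h.norm_lt h.q0
  have := h.cw.theta_ne_zero h.norm_lt h.q0
  have := h.dz.theta_ne_zero h.norm_lt h.q0
  have := h.dw.theta_ne_zero h.norm_lt h.q0
  have := h.ca.poch_ne_zero h.norm_lt h.q0
  have := h.da.poch_ne_zero h.norm_lt h.q0
  have := h.γsq.poch_ne_zero h.norm_lt h.q0
  have := h.γsq_inv.poch_ne_zero h.norm_lt h.q0
  clear e1 e2 e3 h
  iterate 10 generalize poch _ _ = X at *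
  iterate 12 generalize theta _ _ = X at *
  field_simp

lemma u2Fun_eq (h : Regular (q : ℂ) a b c d (sP q a b c d) zp zm γ) :
    u2Fun q zm zp a b c d γ =
      -(poch q (sP q a b c d * γ) * poch q (sP q a b c d / γ) *
          (poch q (c * q * γ / (a * sP q a b c d)) * poch q (d * q * γ / (a * sP q a b c d)) *
            (poch q (c * q / (a * sP q a b c d * γ)) * poch q (d * q / (a * sP q a b c d * γ)))) *
          (poch q (c * q * γ / (b * sP q a b c d)) * poch q (d * q * γ / (b * sP q a b c d)) *
            (poch q (c * q / (b * sP q a b c d * γ)) * poch q (d * q / (b * sP q a b c d * γ)))) *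
          (1 - q) * (zm * theta q (zp / zm) * theta q (c * d * zm * zp))) /
        (poch q (c * q / a) * poch q (d * q / a) * (poch q (c * q / b) * poch q (d * q / b)) *
          (poch q (γ ^ 2) * poch q (γ⁻¹ ^ 2)) *
          (theta q (c * zp) * theta q (c * zm) * theta q (d * zp) * theta q (d * zm))) := by
  simp only [u2Fun, Kz, cz]
  rw [sP_swap (a := a) (b := b)]
  generalize sP q a b c d = s at *
  have hA := theta_sub_eq_of_mul_sq_eq h.norm_lt h.q0 h.a0 h.b0 h.c0 h.d0 h.s0 h.z0 h.w0 h.γ0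
    h.mul_sq
  rw [h.theta_mul_theta] at hA
  have e1 : 1 / γ ^ 2 = γ⁻¹ ^ 2 := by simp
  have e2 : 1 / γ⁻¹ ^ 2 = γ ^ 2 := by simp
  have e3 : ∀ x : ℂ, x / γ⁻¹ = x * γ := fun x => by simp
  simp only [e1, e2, e3, ← div_eq_mul_inv, div_div_eq_mul_div]
  have := h.az.theta_ne_zero h.norm_lt h.q0
  have := h.aw.theta_ne_zero h.norm_lt h.q0
  have := h.bz.theta_ne_zero h.norm_lt h.q0
  have := h.bw.theta_ne_zero h.norm_lt h.q0
  have := h.cz.theta_ne_zero h.norm_lt h.q0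
  have := h.cw.theta_ne_zero h.norm_lt h.q0
  have := h.dz.theta_ne_zero h.norm_lt h.q0
  have := h.dw.theta_ne_zero h.norm_lt h.q0
  have := h.ca.poch_ne_zero h.norm_lt h.q0
  have := h.da.poch_ne_zero h.norm_lt h.q0
  have := h.cb.poch_ne_zero h.norm_lt h.q0
  have := h.db.poch_ne_zero h.norm_lt h.q0
  have := h.γsq.poch_ne_zero h.norm_lt h.q0
  have := h.γsq_inv.poch_ne_zero h.norm_lt h.q0
  clear e1 e2 e3 h
  generalize poch _ (s * γ) = p at *
  generalize poch _ (s / γ) = p' at *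
  generalize poch _ (c * q / (a * s * γ)) = y₁ at *
  generalize poch _ (d * q / (a * s * γ)) = y₂ at *
  generalize poch _ (c * q * γ / (b * s)) = y₃ at *
  generalize poch _ (d * q * γ / (b * s)) = y₄ at *
  iterate 10 generalize poch _ _ = X at *
  iterate 14 generalize theta _ _ = X at *
  field_simp
  linear_combination ((1 - (q : ℂ)) * p' * y₁ * y₂ * p * y₃ * y₄) * hA

lemma u2Fun_swap (h : Regular (q : ℂ) a b c d (sP q a b c d) zp zm γ) :
    u2Fun q zm zp b a c d γ = u2Fun q zm zp a b c d γ := by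
  rw [u2Fun_eq h, u2Fun_eq (by simpa only [sP_swap (a := a) (b := b)] using h.swap),
    sP_swap (a := a) (b := b)]
  congr 1 <;> ring

lemma v2Fun_swap : v2Fun q zm zp b a c d γ = v2Fun q zm zp a b c d γ := by
  simp only [v2Fun, sP_swap (a := a) (b := b), mul_comm b a]
  congr 2 <;> ring

lemma v1Fun_eq : v1Fun q zm zp a b c d γ =
    -(poch q (c * q / a) ^ 2 * poch q (d * q / a) ^ 2 * theta q (b * zp) * theta q (b * zm) /
        ((1 - q) * a * b * zm ^ 2 * zp ^ 2 *
          (theta q (zm / zp) * theta q (zp / zm) * theta q (a / b) * theta q (b / a))) *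
      (poch q (γ ^ 2) * poch q (γ⁻¹ ^ 2) /
        (poch q (sP q a b c d * γ) * poch q (sP q a b c d / γ) *
          poch q (c * q * γ / (a * sP q a b c d)) * poch q (c * q / (a * sP q a b c d * γ)) *
          poch q (d * q * γ / (a * sP q a b c d)) * poch q (d * q / (a * sP q a b c d * γ)) *
          (theta q (sP q a b c d * γ) * theta q (sP q a b c d / γ) *
            theta q (a * b * sP q a b c d * zm * zp * γ) *
            theta q (a * b * sP q a b c d * zm * zp / γ)))) *
      u1Num q b a c d (sP q a b c d) zp zm γ) := by
  simp only [v1Fun, u1Num]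
  ring

lemma u1Fun_mul_v2Fun_add (h : Regular (q : ℂ) a b c d (sP q a b c d) zp zm γ) :
    u1Fun q zm zp b a c d γ * v2Fun q zm zp a b c d γ +
      u2Fun q zm zp a b c d γ * v1Fun q zm zp a b c d γ = 0 := by
  rw [u2Fun_eq h, u1Fun_eq (by simpa only [sP_swap (a := a) (b := b)] using h.swap),
    sP_swap (a := a) (b := b), v1Fun_eq, h.theta_inv_ratio]
  simp only [v2Fun]
  generalize sP q a b c d = s at *
  have := h.a0
  have := h.b0
  have := h.z0
  have := h.w0
  have : (1 : ℂ) - q ≠ 0 := fun h' => by simpa [← sub_eq_zero.1 h'] using h.norm_lt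
  have := h.cd_div.1.poch_ne_zero h.norm_lt h.q0
  have := h.cd_div.2.poch_ne_zero h.norm_lt h.q0
  have := h.swap.cd_div.1.poch_ne_zero h.norm_lt h.q0
  have := h.swap.cd_div.2.poch_ne_zero h.norm_lt h.q0
  have := h.caγ.poch_ne_zero h.norm_lt h.q0
  have := h.daγ.poch_ne_zero h.norm_lt h.q0
  have := h.cbγ.poch_ne_zero h.norm_lt h.q0
  have := h.dbγ.poch_ne_zero h.norm_lt h.q0
  have := h.sγ.poch_ne_zero h.norm_lt h.q0
  have := h.sγ'.poch_ne_zero h.norm_lt h.q0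
  have := h.ca.poch_ne_zero h.norm_lt h.q0
  have := h.da.poch_ne_zero h.norm_lt h.q0
  have := h.cb.poch_ne_zero h.norm_lt h.q0
  have := h.db.poch_ne_zero h.norm_lt h.q0
  have := h.γsq.poch_ne_zero h.norm_lt h.q0
  have := h.γsq_inv.poch_ne_zero h.norm_lt h.q0
  have := h.sγ.theta_ne_zero h.norm_lt h.q0
  have := h.sγ'.theta_ne_zero h.norm_lt h.q0
  have := h.abγ.theta_ne_zero h.norm_lt h.q0
  have := h.abγ'.theta_ne_zero h.norm_lt h.q0
  have := h.ab.theta_ne_zero h.norm_lt h.q0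
  have := h.swap.ab.theta_ne_zero h.norm_lt h.q0
  have := h.zw.theta_ne_zero h.norm_lt h.q0
  have := h.az.theta_ne_zero h.norm_lt h.q0
  have := h.aw.theta_ne_zero h.norm_lt h.q0
  have := h.bz.theta_ne_zero h.norm_lt h.q0
  have := h.bw.theta_ne_zero h.norm_lt h.q0
  have := h.cz.theta_ne_zero h.norm_lt h.q0
  have := h.cw.theta_ne_zero h.norm_lt h.q0
  have := h.dz.theta_ne_zero h.norm_lt h.q0
  have := h.dw.theta_ne_zero h.norm_lt h.q0
  clear h
  generalize u1Num _ _ _ _ _ _ _ _ _ = M at *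
  iterate 16 generalize poch _ _ = X at *
  iterate 16 generalize theta _ _ = X at *
  field_simp
  ring

lemma u2Fun_mul_v2Fun_add (h : Regular (q : ℂ) a b c d (sP q a b c d) zp zm γ) :
    u2Fun q zm zp a b c d γ * v2Fun q zm zp a b c d γ +
      u1Fun q zm zp a b c d γ * v1Fun q zm zp a b c d γ = 1 := by
  rw [u2Fun_eq h, u1Fun_eq h, v1Fun_eq, h.theta_inv_ratio]
  simp only [v2Fun]
  rw [h.swap.theta_inv_ratio']
  generalize sP q a b c d = s at *
  have hP := h.u1Num_mul_u1Num
  have := h.a0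
  have := h.b0
  have := h.z0
  have := h.w0
  have : (1 : ℂ) - q ≠ 0 := fun h' => by simpa [← sub_eq_zero.1 h'] using h.norm_lt
  have := h.cd_div.1.poch_ne_zero h.norm_lt h.q0
  have := h.cd_div.2.poch_ne_zero h.norm_lt h.q0
  have := h.swap.cd_div.1.poch_ne_zero h.norm_lt h.q0
  have := h.swap.cd_div.2.poch_ne_zero h.norm_lt h.q0
  have := h.caγ.poch_ne_zero h.norm_lt h.q0
  have := h.daγ.poch_ne_zero h.norm_lt h.q0
  have := h.cbγ.poch_ne_zero h.norm_lt h.q0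
  have := h.dbγ.poch_ne_zero h.norm_lt h.q0
  have := h.sγ.poch_ne_zero h.norm_lt h.q0
  have := h.sγ'.poch_ne_zero h.norm_lt h.q0
  have := h.ca.poch_ne_zero h.norm_lt h.q0
  have := h.da.poch_ne_zero h.norm_lt h.q0
  have := h.cb.poch_ne_zero h.norm_lt h.q0
  have := h.db.poch_ne_zero h.norm_lt h.q0
  have := h.γsq.poch_ne_zero h.norm_lt h.q0
  have := h.γsq_inv.poch_ne_zero h.norm_lt h.q0
  have := h.sγ.theta_ne_zero h.norm_lt h.q0
  have := h.sγ'.theta_ne_zero h.norm_lt h.q0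
  have := h.abγ.theta_ne_zero h.norm_lt h.q0
  have := h.abγ'.theta_ne_zero h.norm_lt h.q0
  have := h.swap.ab.theta_ne_zero h.norm_lt h.q0
  have := h.zw.theta_ne_zero h.norm_lt h.q0
  have := h.az.theta_ne_zero h.norm_lt h.q0
  have := h.aw.theta_ne_zero h.norm_lt h.q0
  have := h.bz.theta_ne_zero h.norm_lt h.q0
  have := h.bw.theta_ne_zero h.norm_lt h.q0
  have := h.cz.theta_ne_zero h.norm_lt h.q0
  have := h.cw.theta_ne_zero h.norm_lt h.q0
  have := h.dz.theta_ne_zero h.norm_lt h.q0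
  have := h.dw.theta_ne_zero h.norm_lt h.q0
  clear h
  generalize u1Num _ a _ _ _ _ _ _ _ = M at *
  generalize u1Num _ b _ _ _ _ _ _ _ = M' at *
  iterate 16 generalize poch _ _ = X at *
  iterate 16 generalize theta _ _ = X at *
  field_simp
  linear_combination hP

end Matrices

section Parameters

variable {q zm zp : ℝ} {a b c d α β γ : ℂ}

lemma zpow_mem_Ioo_inv_self (hq0 : 0 < q) (hq1 : q < 1) {k : ℤ} (h1 : q < q ^ k)
    (h2 : q * q ^ k < 1) : k = 0 := by
  have e1 : k < 1 := (zpow_lt_zpow_iff_right_of_lt_one₀ hq0 hq1).1 (by simpa using h1)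
  have e2 : 0 < k + 1 := (zpow_lt_zpow_iff_right_of_lt_one₀ hq0 hq1).1 (by
    rw [zpow_add_one₀ hq0.ne', zpow_zero]; linarith)
  omega

lemma norm_mul_lt_of_between {z A B : ℝ} {k : ℤ} (hq0 : 0 < q) (hz : 0 < z)
    (h1 : z * q ^ k < 1 / B) (h2 : 1 / B < 1 / A) (h3 : 1 / A < z * q ^ (k - 1)) :
    0 < A ∧ A < B ∧ q * B < A := by
  have hk : 0 < z * q ^ k := by positivity
  have hB : 0 < B := one_div_pos.1 (hk.trans h1)
  have hA : 0 < A := one_div_pos.1 ((hk.trans h1).trans h2)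
  have e : z * q ^ (k - 1) = z * q ^ k / q := by rw [zpow_sub_one₀ hq0.ne']; ring
  refine ⟨hA, (one_div_lt_one_div hB hA).1 h2, ?_⟩
  rw [e, lt_div_iff₀ hq0, one_div, inv_mul_lt_iff₀ hA] at h3
  rw [one_div, lt_inv_comm₀ hk hB, ← one_div, lt_div_iff₀ hk] at h1
  nlinarith

/-- The consequences of the pair condition used below. -/
lemma pairCond.norm (h : pairCond q zm zp α β) (hq0 : 0 < q) (hq1 : q < 1) (hzm : zm < 0)
    (hzp : 0 < zp) (hα : α ≠ 0) (hβ : β ≠ 0) :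
    α * β = ((‖α‖ * ‖β‖ : ℝ) : ℂ) ∧ q * ‖β‖ < ‖α‖ ∧ q * ‖α‖ < ‖β‖ ∧
      (‖α‖ = ‖β‖ ∨ α.im = 0 ∧ β.im = 0) := by
  have hα' := norm_pos_iff.2 hα
  have hβ' := norm_pos_iff.2 hβ
  rcases h with h | ⟨A, B, k, rfl, rfl, h1, h2, h3⟩ | ⟨A, B, k, rfl, rfl, h1, h2, h3⟩
  · subst h
    simp only [RCLike.norm_conj] at *
    refine ⟨?_, by nlinarith, by nlinarith, Or.inl trivial⟩
    rw [mul_comm, Complex.mul_conj']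
    push_cast
    ring
  · obtain ⟨hA, hAB, hBA⟩ := norm_mul_lt_of_between hq0 hzp h1 h2 h3
    have hB : 0 < B := hA.trans hAB
    simp only [Complex.norm_real, Real.norm_eq_abs, abs_of_pos hA, abs_of_pos hB]
    refine ⟨by push_cast; ring, hBA, by nlinarith, Or.inr (by simp)⟩
  · obtain ⟨hA, hAB, hBA⟩ := norm_mul_lt_of_between (z := -zm) (A := -A) (B := -B) (k := k) hq0
      (by linarith) (by rw [one_div_neg_eq_neg_one_div]; linarith)
      (by simp only [one_div_neg_eq_neg_one_div]; linarith)
      (by rw [one_div_neg_eq_neg_one_div]; linarith)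
    have hB : 0 < -B := hA.trans hAB
    simp only [Complex.norm_real, Real.norm_eq_abs, abs_of_neg (neg_pos.1 hA),
      abs_of_neg (neg_pos.1 hB)]
    refine ⟨by push_cast; ring, hBA, by nlinarith, Or.inr (by simp)⟩

lemma im_ne_zero_of_norm_eq_one (hγ : ‖γ‖ = 1) (h1 : γ ≠ 1) (h2 : γ ≠ -1) : γ.im ≠ 0 := by
  intro h
  have hre : γ = (γ.re : ℂ) := Complex.ext (by simp) (by simp [h])
  rw [hre, Complex.norm_real, Real.norm_eq_abs] at hγ
  rcases eq_or_eq_neg_of_abs_eq hγ with h' | h'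
  · exact h1 (by rw [hre, h', Complex.ofReal_one])
  · exact h2 (by rw [hre, h', Complex.ofReal_neg, Complex.ofReal_one])

lemma offLattice_ofReal_mul {R : ℝ} (hR : R ≠ 0) (hγ : γ.im ≠ 0) :
    OffLattice (q : ℂ) (R * γ) := by
  refine ⟨mul_ne_zero (by exact_mod_cast hR) fun h => hγ (by simp [h]), fun k hk => ?_⟩
  rw [← Complex.ofReal_zpow] at hk
  simpa [hR, hγ, -Complex.ofReal_zpow] using congrArg Complex.im hk

lemma mul_ne_zpow_two_mul {m n : ℝ} (hq0 : 0 < q) (hq1 : q < 1) (hn : 0 < n) (h1 : q * m < n)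
    (h2 : q * n < m) (k : ℤ) : q * m ≠ q ^ (2 * k) * n := by
  intro h
  have e1 : 0 < 2 * k := (zpow_lt_zpow_iff_right_of_lt_one₀ hq0 hq1).1 (by
    rw [zpow_zero]; nlinarith)
  have e2 : 2 * k < 2 := (zpow_lt_zpow_iff_right_of_lt_one₀ hq0 hq1).1 (by
    rw [zpow_ofNat]; nlinarith)
  omega

lemma offLattice_ratio {x x' y y' : ℂ} {S : ℝ} (hq0 : 0 < q) (hq1 : q < 1)
    (hx : x ≠ 0) (hx' : x' ≠ 0) (hy : y ≠ 0) (hy' : y' ≠ 0) (hS : 0 < S)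
    (hS2 : ‖y‖ * ‖y'‖ * S ^ 2 = ‖x‖ * ‖x'‖ * q)
    (hx1 : q * ‖x'‖ < ‖x‖) (hx2 : q * ‖x‖ < ‖x'‖) (hx3 : ‖x‖ = ‖x'‖ ∨ x.im = 0 ∧ x'.im = 0)
    (hy1 : q * ‖y'‖ < ‖y‖) (hy2 : q * ‖y‖ < ‖y'‖) (hy3 : ‖y‖ = ‖y'‖ ∨ y.im = 0 ∧ y'.im = 0)
    (hγ : ‖γ‖ = 1) (hγi : γ.im ≠ 0) :
    OffLattice (q : ℂ) (x * q * γ / (y * S)) := by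
  have hqc : (q : ℂ) ≠ 0 := by exact_mod_cast hq0.ne'
  have hSc : (S : ℂ) ≠ 0 := by exact_mod_cast hS.ne'
  have hγ0 : γ ≠ 0 := fun h => hγi (by simp [h])
  have px := norm_pos_iff.2 hx
  have px' := norm_pos_iff.2 hx'
  have py := norm_pos_iff.2 hy
  have py' := norm_pos_iff.2 hy'
  refine ⟨by simp [*], fun k hk => ?_⟩
  rw [div_eq_iff (mul_ne_zero hy hSc)] at hk
  have hn := congrArg norm hk
  simp only [norm_mul, norm_zpow, hγ, Complex.norm_real, Real.norm_eq_abs, abs_of_pos hq0,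
    abs_of_pos hS, mul_one] at hn
  have key : q * (‖x‖ * ‖y'‖) = q ^ (2 * k) * (‖y‖ * ‖x'‖) := by
    refine mul_left_cancel₀ (mul_pos px hq0).ne' ?_
    rw [mul_comm 2 k, zpow_mul, zpow_ofNat]
    linear_combination ‖y'‖ * (‖x‖ * q + q ^ k * (‖y‖ * S)) * hn + (q ^ k) ^ 2 * ‖y‖ * hS2
  rcases hx3 with hx3 | hx3
  · refine mul_ne_zpow_two_mul hq0 hq1 py hy1 hy2 k (mul_left_cancel₀ px.ne' ?_)
    rw [← hx3] at key
    linear_combination key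
  rcases hy3 with hy3 | hy3
  · refine mul_ne_zpow_two_mul hq0 hq1 px' hx2 hx1 k (mul_left_cancel₀ py.ne' ?_)
    rw [← hy3] at key
    linear_combination key
  have ex : x = (x.re : ℂ) := Complex.ext (by simp) (by simp [hx3.1])
  have ey : y = (y.re : ℂ) := Complex.ext (by simp) (by simp [hy3.1])
  have hxr : x.re ≠ 0 := fun h => hx (by rw [ex, h, Complex.ofReal_zero])
  rw [ex, ey, ← Complex.ofReal_zpow] at hk
  simpa [hxr, hq0.ne', hγi, -Complex.ofReal_zpow] using congrArg Complex.im hk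

lemma exists_sP_eq (hq0 : 0 < q) (ha : a ≠ 0) (hb : b ≠ 0) (hc : c ≠ 0) (hd : d ≠ 0)
    (hab : a * b = ((‖a‖ * ‖b‖ : ℝ) : ℂ)) (hcd : c * d = ((‖c‖ * ‖d‖ : ℝ) : ℂ)) :
    ∃ S : ℝ, 0 < S ∧ sP q a b c d = S ∧ ‖a‖ * ‖b‖ * S ^ 2 = ‖c‖ * ‖d‖ * q := by
  have pa := norm_pos_iff.2 ha
  have pb := norm_pos_iff.2 hb
  have pc := norm_pos_iff.2 hc
  have pd := norm_pos_iff.2 hd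
  have hpos : 0 < ‖c‖ * ‖d‖ * q / (‖a‖ * ‖b‖) := by positivity
  refine ⟨(‖c‖ * ‖d‖ * q / (‖a‖ * ‖b‖)) ^ ((1 : ℝ) / 2), by positivity, ?_, ?_⟩
  · rw [sP, hab, hcd, Complex.ofReal_cpow hpos.le]
    push_cast
    rfl
  · rw [← Real.sqrt_eq_rpow, Real.sq_sqrt hpos.le]
    field_simp

lemma memPgen.regular (h : memPgen q zm zp a b c d) (hq0 : 0 < q) (hq1 : q < 1) (hzm : zm < 0)
    (hzp : 0 < zp) (hγ : ‖γ‖ = 1) (h1 : γ ≠ 1) (h2 : γ ≠ -1) :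
    Regular (q : ℂ) a b c d (sP q a b c d) zp zm γ := by
  obtain ⟨⟨ha, hb, hc, hd, hab, hz, hpab, hpcd⟩, -, hrat⟩ := h
  obtain ⟨ab0, ab1, ab2, ab3⟩ := hpab.norm hq0 hq1 hzm hzp ha hb
  obtain ⟨cd0, cd1, cd2, cd3⟩ := hpcd.norm hq0 hq1 hzm hzp hc hd
  obtain ⟨S, hS, hsP, hS2⟩ := exists_sP_eq hq0 ha hb hc hd ab0 cd0
  rw [hsP]
  have ab3' : ‖b‖ = ‖a‖ ∨ b.im = 0 ∧ a.im = 0 := ab3.imp Eq.symm And.symm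
  have cd3' : ‖d‖ = ‖c‖ ∨ d.im = 0 ∧ c.im = 0 := cd3.imp Eq.symm And.symm
  have hqc : (q : ℂ) ≠ 0 := by exact_mod_cast hq0.ne'
  have hSc : (S : ℂ) ≠ 0 := by exact_mod_cast hS.ne'
  have hzpc : (zp : ℂ) ≠ 0 := by exact_mod_cast hzp.ne'
  have hzmc : (zm : ℂ) ≠ 0 := by exact_mod_cast hzm.ne
  have hγi := im_ne_zero_of_norm_eq_one hγ h1 h2
  have hγ0 : γ ≠ 0 := fun h => hγi (by simp [h])
  have hγi' : γ⁻¹.im ≠ 0 := by simp [hγi, hγ0]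
  have hna := norm_pos_iff.2 ha
  have hnb := norm_pos_iff.2 hb
  have hp : ∀ x ∈ ({a, b, c, d} : Set ℂ), x ≠ 0 →
      OffLattice (q : ℂ) (x * zp) ∧ OffLattice (q : ℂ) (x * zm) := fun x hx hx0 => by
    refine ⟨⟨mul_ne_zero hx0 hzpc, fun k hk => (hz x hx k).1 ?_⟩,
      ⟨mul_ne_zero hx0 hzmc, fun k hk => (hz x hx k).2 ?_⟩⟩
    · rw [← hk, mul_comm x, inv_mul_cancel_left₀ hzpc]
    · rw [← hk, mul_comm x, inv_mul_cancel_left₀ hzmc]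
  have hR : ∀ x : ℂ, a * b * S * zm * zp * x =
      ((‖a‖ * ‖b‖ * S * zm * zp : ℝ) : ℂ) * x := fun x => by rw [ab0]; push_cast; ring
  have hR0 : ‖a‖ * ‖b‖ * S * zm * zp ≠ 0 := by
    simp [ha, hb, hS.ne', hzm.ne, hzp.ne']
  exact
    { norm_lt := by rwa [Complex.norm_real, Real.norm_eq_abs, abs_of_pos hq0]
      q0 := hqc
      a0 := ha
      b0 := hb
      c0 := hc
      d0 := hd
      s0 := hSc
      z0 := hzpc
      w0 := hzmc
      γ0 := hγ0
      mul_sq := by rw [ab0, cd0]; exact_mod_cast hS2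
      ab := by
        refine ⟨div_ne_zero ha hb, fun k hk => ?_⟩
        have hn := congrArg norm hk
        simp only [norm_div, norm_zpow, Complex.norm_real, Real.norm_eq_abs,
          abs_of_pos hq0] at hn
        have hk0 : k = 0 := zpow_mem_Ioo_inv_self hq0 hq1
          (by rwa [← hn, lt_div_iff₀ hnb])
          (by rwa [← hn, ← mul_div_assoc, div_lt_one hnb])
        rw [hk0, zpow_zero, div_eq_one_iff_eq hb] at hk
        exact hab hk
      zw := by
        refine ⟨div_ne_zero hzpc hzmc, fun k hk => ?_⟩
        have hk' : zp / zm = q ^ k := by exact_mod_cast hk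
        exact absurd (div_neg_of_pos_of_neg hzp hzm) (not_lt.2 (by rw [hk']; positivity))
      az := (hp a (by simp) ha).1
      aw := (hp a (by simp) ha).2
      bz := (hp b (by simp) hb).1
      bw := (hp b (by simp) hb).2
      cz := (hp c (by simp) hc).1
      cw := (hp c (by simp) hc).2
      dz := (hp d (by simp) hd).1
      dw := (hp d (by simp) hd).2
      ca := by
        rw [mul_div_right_comm]
        exact OffLattice.mul_base ⟨div_ne_zero hc ha, fun k => (hrat k).1⟩ hqc
      cb := by
        rw [mul_div_right_comm]
        exact OffLattice.mul_base ⟨div_ne_zero hc hb, fun k => (hrat k).2.1⟩ hqc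
      da := by
        rw [mul_div_right_comm]
        exact OffLattice.mul_base ⟨div_ne_zero hd ha, fun k => (hrat k).2.2.1⟩ hqc
      db := by
        rw [mul_div_right_comm]
        exact OffLattice.mul_base ⟨div_ne_zero hd hb, fun k => (hrat k).2.2.2.1⟩ hqc
      γsq := by
        refine ⟨pow_ne_zero 2 hγ0, fun k hk => ?_⟩
        have hn := congrArg norm hk
        simp only [norm_pow, norm_zpow, hγ, one_pow, Complex.norm_real, Real.norm_eq_abs,
          abs_of_pos hq0] at hn
        rw [← Complex.ofReal_zpow, ← hn, Complex.ofReal_one] at hk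
        rw [sq] at hk
        rcases mul_self_eq_one_iff.1 hk with h | h
        · exact h1 h
        · exact h2 h
      sγ := offLattice_ofReal_mul hS.ne' hγi
      sγ' := by
        rw [div_eq_mul_inv]
        exact offLattice_ofReal_mul hS.ne' hγi'
      abγ := by
        rw [hR]
        exact offLattice_ofReal_mul hR0 hγi
      abγ' := by
        rw [div_eq_mul_inv, hR]
        exact offLattice_ofReal_mul hR0 hγi'
      caγ := offLattice_ratio hq0 hq1 hc hd ha hb hS hS2 cd1 cd2 cd3 ab1 ab2 ab3 hγ hγi
      daγ := offLattice_ratio hq0 hq1 hd hc ha hb hS (by linarith) cd2 cd1 cd3' ab1 ab2 ab3 hγ hγi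
      cbγ := offLattice_ratio hq0 hq1 hc hd hb ha hS (by linarith) cd1 cd2 cd3 ab2 ab1 ab3' hγ hγi
      dbγ := offLattice_ratio hq0 hq1 hd hc hb ha hS (by linarith) cd2 cd1 cd3' ab2 ab1 ab3'
        hγ hγi }

end Parameters

/-- the matrices `u(γ)` and `v(γ)` are mutually inverse on the unit
circle minus `{±1}`. -/
theorem statement16 (q zm zp : ℝ) (a b c d : ℂ)
    (hq0 : 0 < q) (hq1 : q < 1) (hzm : zm < 0) (hzp : 0 < zp)
    (hPg : memPgen q zm zp a b c d) (γ : ℂ)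
    (hγ : ‖γ‖ = 1) (h1 : γ ≠ 1) (h2 : γ ≠ -1) :
    (!![u2Fun q zm zp a b c d γ, u1Fun q zm zp a b c d γ;
        u1Fun q zm zp b a c d γ, u2Fun q zm zp a b c d γ] *
      !![v2Fun q zm zp a b c d γ, v1Fun q zm zp b a c d γ;
        v1Fun q zm zp a b c d γ, v2Fun q zm zp a b c d γ] :
      Matrix (Fin 2) (Fin 2) ℂ) = 1 := by
  have hR := hPg.regular hq0 hq1 hzm hzp hγ h1 h2
  have hR' : Regular (q : ℂ) b a c d (sP q b a c d) zp zm γ := by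
    simpa only [sP_swap (a := a) (b := b)] using hR.swap
  have h11 := u2Fun_mul_v2Fun_add hR
  have h21 := u1Fun_mul_v2Fun_add hR
  have h12 := u1Fun_mul_v2Fun_add hR'
  have h22 := u2Fun_mul_v2Fun_add hR'
  rw [u2Fun_swap hR, v2Fun_swap] at h12 h22
  rw [Matrix.mul_fin_two, Matrix.one_fin_two, h11, h21, add_comm, h12, add_comm, h22]
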